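/- Let t and k be integers with 0 <= t <= min(r_n - 1, s_n - 1) and m + M + 1 <= k <= p^n, and suppose l = t p^n + k satisfies max(r+s-p^{n+1},0)+1 <= l <= min(r,s). Then: (1) the element z_l = (-1)^{R+k-S-1} sum_{i=0}^{t} (-1)^i v_{(i+1) p^n + R + S + 1 - k, (t-i+1) p^n} of M(r,s) satisfies T^{p^n - 1}(z_l) = x_{(t+1) p^n + R + S + 1 - k}; (2) the (t+1) x (t+1) matrix M(5) over F with (i,j) entry C(r_n+s_n-2t-2, r_n-t+j-i-1) is invertible, and with zeta = M(5)^{-1} X, where X is the column vector of length t+1 with i-th entry (-1)^{i-1}, the element y_l = (-1)^{k+R-S-1} sum_{i=0}^{t} zeta_{i+1} v_{(r_n-t+i) p^n + R + S + 1 - k, (s_n-i) p^n} satisfies T^{(r_n+s_n-2t-2) p^n}(y_l) = z_l. -/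

import Mathlib

open scoped BigOperators

noncomputable section

/-- The basis vector `v_{a,b}` of `M(r,s)` (1-indexed), read as `0` when
`a` or `b` is out of range. -/
def vv (F : Type*) [Field F] (r s : ℕ) (a b : ℤ) : Matrix (Fin r) (Fin s) F :=
  Matrix.of fun i j => if (i : ℤ) + 1 = a ∧ (j : ℤ) + 1 = b then 1 else 0

/-- The linear endomorphism `T` of `M(r,s)` with `T(v_{i,j}) = v_{i-1,j} + v_{i,j-1}`
(out-of-range symbols read as `0`); it models the action of `g - 1`. -/
def TT (F : Type*) [Field F] (r s : ℕ) :
    Matrix (Fin r) (Fin s) F →ₗ[F] Matrix (Fin r) (Fin s) F where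
  toFun A := Matrix.of fun i j =>
    (if h : (i : ℕ) + 1 < r then A ⟨(i : ℕ) + 1, h⟩ j else 0) +
    (if h : (j : ℕ) + 1 < s then A i ⟨(j : ℕ) + 1, h⟩ else 0)
  map_add' A B := by
    ext i j
    simp only [Matrix.of_apply, Matrix.add_apply]
    split_ifs <;> abel
  map_smul' c A := by
    ext i j
    simp only [Matrix.of_apply, Matrix.smul_apply, RingHom.id_apply, smul_eq_mul]
    split_ifs <;> ring

/-- `x_m = ∑_{j=1}^m (-1)^{j-1} v_{j, m+1-j}` (the empty sum if `m ≤ 0`). -/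
def xx (F : Type*) [Field F] (r s : ℕ) (m : ℤ) : Matrix (Fin r) (Fin s) F :=
  ∑ j ∈ Finset.range m.toNat, ((-1 : F) ^ j) • vv F r s ((j : ℤ) + 1) (m - j)

/-- The subspace `D_d` of `M(r,s)`, spanned by the `v_{i,j}` with `i + j = d + 1`. -/
def Dd (F : Type*) [Field F] (r s : ℕ) (d : ℕ) :
    Submodule F (Matrix (Fin r) (Fin s) F) :=
  Submodule.span F { A | ∃ a b : ℕ, 1 ≤ a ∧ a ≤ r ∧ 1 ≤ b ∧ b ≤ s ∧
    a + b = d + 1 ∧ A = vv F r s (a : ℤ) (b : ℤ) }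

/-- Binomial coefficient `C(a,b)` as an element of `F`, with the convention that
it is `0` when `b < 0` or `b > a`. -/
def binF (F : Type*) [Field F] (a b : ℤ) : F :=
  if 0 ≤ b ∧ b ≤ a then (Nat.choose a.toNat b.toNat : F) else 0

/-- `lam` (restricted to indices `1,…,min r s`) is the Jordan type of the nilpotent
operator `T` on `M(r,s)`: a nonincreasing list of `min r s` positive integers such that
for each `m ≥ 1` the number of parts `≥ m` is `rank T^{m-1} - rank T^m`. -/
def IsJordanType (F : Type*) [Field F] (r s : ℕ) (lam : ℕ → ℕ) : Prop :=
  (∀ l, 1 ≤ l → l ≤ min r s → 0 < lam l) ∧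
  (∀ l l', 1 ≤ l → l ≤ l' → l' ≤ min r s → lam l' ≤ lam l) ∧
  ∀ m, 1 ≤ m →
    ((Finset.Icc 1 (min r s)).filter fun l => m ≤ lam l).card =
      Module.finrank F ↥(LinearMap.range ((TT F r s) ^ (m - 1))) -
      Module.finrank F ↥(LinearMap.range ((TT F r s) ^ m))

theorem vv_of_fst_nonpos (F : Type*) [Field F] (r s : ℕ) {a : ℤ} (b : ℤ) (ha : a ≤ 0) :
    vv F r s a b = 0 := by
  ext i j
  simp only [vv, Matrix.of_apply, Matrix.zero_apply]
  rw [if_neg]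
  omega

theorem vv_of_snd_nonpos (F : Type*) [Field F] (r s : ℕ) (a : ℤ) {b : ℤ} (hb : b ≤ 0) :
    vv F r s a b = 0 := by
  ext i j
  simp only [vv, Matrix.of_apply, Matrix.zero_apply]
  rw [if_neg]
  omega

theorem TT_vv (F : Type*) [Field F] (r s : ℕ) (a b : ℤ) (ha : a ≤ r) (hb : b ≤ s) :
    TT F r s (vv F r s a b) = vv F r s (a - 1) b + vv F r s a (b - 1) := by
  ext i j
  simp only [TT, vv, LinearMap.coe_mk, AddHom.coe_mk, Matrix.of_apply, Matrix.add_apply]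
  congr 1
  · split_ifs <;> first | rfl | (exfalso; push_cast at *; omega)
  · split_ifs <;> first | rfl | (exfalso; push_cast at *; omega)

/-- If an operator moves a doubly indexed family as the sum of two commuting shifts by `d`, its
powers move it according to the binomial theorem. -/
theorem pow_apply_eq_sum_antidiagonal {R M : Type*} [CommRing R] [AddCommGroup M] [Module R M]
    (L : M →ₗ[R] M) (f : ℤ → ℤ → M) (A B : ℤ) (d : ℕ)
    (h : ∀ a b, a ≤ A → b ≤ B → L (f a b) = f (a - d) b + f a (b - d)) (N : ℕ) :
    ∀ a b, a ≤ A → b ≤ B → (L ^ N) (f a b) =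
      ∑ x ∈ Finset.HasAntidiagonal.antidiagonal N, N.choose x.1 • f (a - x.1 * d) (b - x.2 * d) := by
  induction N with
  | zero => intro a b _ _; simp
  | succ N ih =>
    intro a b ha hb
    rw [pow_succ, Module.End.mul_apply, h a b ha hb, map_add, ih (a - d) b (by omega) hb,
      ih a (b - d) ha (by omega),
      Finset.sum_antidiagonal_choose_succ_nsmul
        (fun x y => f (a - (x : ℤ) * d) (b - (y : ℤ) * d)) N, add_comm]
    congr 1
    · refine Finset.sum_congr rfl fun x _ => ?_
      congr 2
      push_cast; ring
    · refine Finset.sum_congr rfl fun x hx => ?_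
      rw [Nat.choose_symm_of_eq_add (Finset.HasAntidiagonal.mem_antidiagonal.mp hx).symm]
      congr 2
      push_cast; ring

theorem TT_pow_vv (F : Type*) [Field F] (r s N : ℕ) (a b : ℤ) (ha : a ≤ r) (hb : b ≤ s) :
    (TT F r s ^ N) (vv F r s a b) =
      ∑ x ∈ Finset.HasAntidiagonal.antidiagonal N, N.choose x.1 • vv F r s (a - x.1) (b - x.2) := by
  have := pow_apply_eq_sum_antidiagonal (TT F r s) (vv F r s) r s 1
    (fun a b ha hb => by simpa using TT_vv F r s a b ha hb) N a b ha hb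
  simpa using this

theorem choose_prime_pow_cast_eq_zero (F : Type*) [Field F] {p n : ℕ} (hp : p.Prime) [CharP F p]
    {x : ℕ} (h0 : x ≠ 0) (h1 : x ≠ p ^ n) : ((p ^ n).choose x : F) = 0 :=
  (CharP.cast_eq_zero_iff F p _).2 (hp.dvd_choose_pow h0 h1)

theorem choose_prime_pow_sub_one_cast (F : Type*) [Field F] {p n : ℕ} (hp : p.Prime) [CharP F p]
    {x : ℕ} (hx : x < p ^ n) : ((p ^ n - 1).choose x : F) = (-1) ^ x := by
  induction x with
  | zero => simp
  | succ x ih =>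
    have h := choose_prime_pow_cast_eq_zero F (n := n) hp (Nat.succ_ne_zero x) hx.ne
    obtain ⟨q, hq⟩ : ∃ q, p ^ n = q + 1 := ⟨p ^ n - 1, by omega⟩
    have ih := ih (by omega)
    rw [hq] at h ih ⊢
    rw [Nat.succ_eq_add_one, Nat.choose_succ_succ] at h
    simp only [Nat.add_sub_cancel, Nat.succ_eq_add_one] at *
    push_cast at h
    rw [pow_succ, ← ih]
    linear_combination h

theorem TT_pow_prime_pow_vv (F : Type*) [Field F] {p n : ℕ} (hp : p.Prime) [CharP F p]
    (r s : ℕ) (a b : ℤ) (ha : a ≤ r) (hb : b ≤ s) :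
    (TT F r s ^ p ^ n) (vv F r s a b) =
      vv F r s (a - (p ^ n : ℕ)) b + vv F r s a (b - (p ^ n : ℕ)) := by
  have hq : 0 < p ^ n := Nat.pow_pos hp.pos
  rw [TT_pow_vv F r s _ a b ha hb, Finset.Nat.sum_antidiagonal_eq_sum_range_succ
    (fun x y => (p ^ n).choose x • vv F r s (a - x) (b - y)), Finset.sum_range_succ,
    Finset.sum_eq_single_of_mem 0 (by simpa using hq)]
  · simp [add_comm]
  · intro x hx h0
    rw [← Nat.cast_smul_eq_nsmul F, choose_prime_pow_cast_eq_zero F hp h0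
      (Finset.mem_range.mp hx).ne, zero_smul]

theorem TT_pow_mul_prime_pow_vv (F : Type*) [Field F] {p n : ℕ} (hp : p.Prime) [CharP F p]
    (r s N : ℕ) (a b : ℤ) (ha : a ≤ r) (hb : b ≤ s) :
    (TT F r s ^ (N * p ^ n)) (vv F r s a b) =
      ∑ x ∈ Finset.HasAntidiagonal.antidiagonal N,
        N.choose x.1 • vv F r s (a - x.1 * (p ^ n : ℕ)) (b - x.2 * (p ^ n : ℕ)) := by
  rw [mul_comm, pow_mul]
  exact pow_apply_eq_sum_antidiagonal _ (vv F r s) r s (p ^ n)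
    (fun a b ha hb => TT_pow_prime_pow_vv F hp r s a b ha hb) N a b ha hb

theorem TT_pow_prime_pow_sub_one_vv (F : Type*) [Field F] {p n : ℕ} (hp : p.Prime) [CharP F p]
    (r s : ℕ) (a b : ℤ) (ha : a ≤ r) (hb : b ≤ s) :
    (TT F r s ^ (p ^ n - 1)) (vv F r s a b) =
      ∑ y ∈ Finset.range (p ^ n),
        (-1 : F) ^ y • vv F r s (a - (p ^ n : ℕ) + 1 + y) (b - y) := by
  have hq : 0 < p ^ n := Nat.pow_pos hp.pos
  rw [TT_pow_vv F r s _ a b ha hb, ← Finset.Nat.sum_antidiagonal_swap,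
    Finset.Nat.sum_antidiagonal_eq_sum_range_succ_mk, Nat.succ_eq_add_one,
    Nat.sub_add_cancel hq]
  refine Finset.sum_congr rfl fun y hy => ?_
  have hy := Finset.mem_range.mp hy
  simp only [Prod.fst_swap, Prod.snd_swap]
  rw [Nat.choose_symm (by omega), ← Nat.cast_smul_eq_nsmul F,
    choose_prime_pow_sub_one_cast F hp hy]
  congr 2
  omega

theorem sum_range_mul_eq_sum_sum {M : Type*} [AddCommMonoid M] (f : ℕ → M) (t q : ℕ) :
    ∑ J ∈ Finset.range (t * q), f J =
      ∑ i ∈ Finset.range t, ∑ y ∈ Finset.range q, f (i * q + y) := by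
  induction t with
  | zero => simp
  | succ t ih => rw [add_mul, one_mul, Finset.sum_range_add, ih, Finset.sum_range_succ]

open Polynomial in
/-- In characteristic `p`, a nonzero polynomial of degree less than `p` vanishes to order less
than its number of terms at `-1`. -/
theorem lt_card_support_of_pow_dvd (F : Type*) [Field F] {p : ℕ} [CharP F p] (d : ℕ) :
    ∀ f : F[X], f ≠ 0 → f.natDegree ≤ d → f.natDegree < p →
      ∀ N, (X + 1) ^ N ∣ f → N < f.support.card := by
  induction d with
  | zero =>
    intro f hf hd _ N hN
    obtain ⟨c, rfl⟩ := natDegree_eq_zero.mp (Nat.le_zero.mp hd)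
    have hN0 : N = 0 := by
      have := natDegree_le_of_dvd hN hf
      rw [natDegree_pow, show (X + 1 : F[X]) = X + C 1 by simp, natDegree_X_add_C,
        natDegree_C] at this
      omega
    rw [hN0, Finset.card_pos, nonempty_support_iff]
    exact hf
  | succ d ih =>
    intro f hf hd hp N hN
    rcases Nat.eq_zero_or_pos f.natDegree with h0 | hpos
    · exact ih f hf (by omega) hp N hN
    by_cases hc : f.coeff 0 = 0
    · obtain ⟨g, rfl⟩ := X_dvd_iff.mpr hc
      have hg : g ≠ 0 := right_ne_zero_of_mul hf
      rw [natDegree_X_mul hg] at hd hp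
      have hcop : IsCoprime ((X + 1 : F[X]) ^ N) X :=
        IsCoprime.pow_left ⟨1, -1, by ring⟩
      refine (ih g hg (by omega) (by omega) N (hcop.dvd_of_dvd_mul_left hN)).trans_le ?_
      refine Finset.card_le_card_of_injOn (· + 1) (fun x hx => ?_) (fun x _ y _ h => by simpa using h)
      simpa [coeff_X_mul] using hx
    · have hcard : (derivative f).support.card + 1 ≤ f.support.card := by
        have h0 : 0 ∈ f.support := by simpa using hc
        rw [← Finset.card_erase_add_one h0]
        refine Nat.add_le_add_right ?_ 1
        refine Finset.card_le_card_of_injOn (· + 1) (fun x hx => ?_)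
          (fun x _ y _ h => by simpa using h)
        simp only [Finset.mem_coe, mem_support_iff, coeff_derivative] at hx
        simpa using left_ne_zero_of_mul hx
      have hder : derivative f ≠ 0 := by
        intro h
        have := congrArg (fun g => g.coeff (f.natDegree - 1)) h
        simp only [coeff_derivative, coeff_zero, Nat.sub_add_cancel hpos] at this
        rcases mul_eq_zero.mp this with h | h
        · exact hf (leadingCoeff_eq_zero.mp h)
        · rw [← Nat.cast_add_one, Nat.sub_add_cancel hpos, CharP.cast_eq_zero_iff F p] at h
          exact absurd (Nat.le_of_dvd hpos h) (by omega)
      have hlt := natDegree_derivative_lt hpos.ne'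
      have := ih _ hder (by omega) (by omega) (N - 1) (pow_sub_one_dvd_derivative_of_pow_dvd hN)
      omega

open Polynomial in
theorem isUnit_of_binF_toeplitz (F : Type*) [Field F] {p : ℕ} [CharP F p] (N u t : ℕ)
    (hu : u ≤ N) (hN : N + t < p) (M : Matrix (Fin (t + 1)) (Fin (t + 1)) F)
    (hM : ∀ i j : Fin (t + 1), M i j = binF F N ((u : ℤ) + (j : ℤ) - (i : ℤ))) : IsUnit M := by
  rw [← Matrix.mulVec_injective_iff_isUnit, ← Matrix.coe_mulVecLin,
    ← LinearMap.ker_eq_bot, LinearMap.ker_eq_bot']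
  intro w hw
  by_contra hw0
  obtain ⟨j₀, hj₀⟩ := Function.ne_iff.mp hw0
  set P : F[X] := ∑ j : Fin (t + 1), C (w j) * X ^ (t - (j : ℕ)) with hP
  have hPdeg : P.natDegree ≤ t :=
    natDegree_sum_le_of_forall_le _ _ fun j _ => (natDegree_C_mul_X_pow_le _ _).trans (by omega)
  have hP0 : P ≠ 0 := by
    intro h
    have h := congrArg (fun g => g.coeff (t - (j₀ : ℕ))) h
    simp only [hP, finsetSum_coeff, coeff_C_mul, coeff_X_pow, coeff_zero] at h
    rw [Finset.sum_eq_single j₀] at h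
    · exact hj₀ (by simpa using h)
    · intro j _ hj
      rw [if_neg, mul_zero]
      intro h; apply hj; ext; omega
    · simp
  have hXmon : ((X + 1 : F[X]) ^ N).Monic := by
    rw [show (X + 1 : F[X]) = X + C 1 by simp]
    exact (monic_X_add_C 1).pow N
  have hXdeg : ((X + 1 : F[X]) ^ N).natDegree = N := by
    rw [show (X + 1 : F[X]) = X + C 1 by simp, natDegree_pow, natDegree_X_add_C, mul_one]
  have hf0 : (X + 1) ^ N * P ≠ 0 := mul_ne_zero hXmon.ne_zero hP0
  have hfdeg : ((X + 1) ^ N * P).natDegree ≤ N + t :=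
    natDegree_mul_le.trans (by omega)
  have hcoeff : ∀ i : Fin (t + 1), ((X + 1) ^ N * P).coeff (u + t - (i : ℕ)) = 0 := by
    intro i
    have h := congrFun hw i
    simp only [Matrix.mulVecLin_apply, Matrix.mulVec, dotProduct, Pi.zero_apply] at h
    rw [hP, Finset.mul_sum, finsetSum_coeff, ← h]
    refine Finset.sum_congr rfl fun j _ => ?_
    rw [mul_left_comm, coeff_C_mul, coeff_mul_X_pow', hM, binF, coeff_X_add_one_pow, mul_comm]
    congr 1
    by_cases h1 : t - (j : ℕ) ≤ u + t - (i : ℕ)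
    · rw [if_pos h1]
      by_cases h2 : (u : ℤ) + j - i ≤ N
      · rw [if_pos (by omega)]
        congr 2
        omega
      · rw [if_neg (by omega), Nat.choose_eq_zero_of_lt (by omega), Nat.cast_zero]
    · rw [if_neg h1, if_neg (by omega)]
  have hsub : ((X + 1) ^ N * P).support ⊆ Finset.range (N + t + 1) \ Finset.Icc u (u + t) := by
    intro e he
    rw [Finset.mem_sdiff, Finset.mem_range, Finset.mem_Icc]
    refine ⟨by have := le_natDegree_of_mem_supp e he; omega, fun h => ?_⟩
    refine mem_support_iff.mp he ?_
    have := hcoeff ⟨u + t - e, by omega⟩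
    rwa [show u + t - (u + t - e) = e by omega] at this
  have hcard := Finset.card_le_card hsub
  rw [Finset.card_sdiff_of_subset
    (fun e he => by rw [Finset.mem_Icc] at he; rw [Finset.mem_range]; omega),
    Finset.card_range, Nat.card_Icc] at hcard
  have := lt_card_support_of_pow_dvd F (p := p) _ _ hf0 le_rfl (by omega) N (dvd_mul_right _ _)
  omega

/-- case `m+M+1 ≤ k ≤ p^n`. -/
theorem stmt19 (p : ℕ) (hp : p.Prime) (F : Type*) [Field F] [CharP F p]
    (r s n rn sn R S : ℕ) (hr : 0 < r) (hs : 0 < s)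
    (hn1 : p ^ n ≤ max r s) (hn2 : max r s < p ^ (n + 1))
    (hrn : rn < p) (hsn : sn < p) (hRp : R < p ^ n) (hSp : S < p ^ n)
    (hrd : r = rn * p ^ n + R) (hsd : s = sn * p ^ n + S)
    (t k l : ℕ) (ht : (t : ℤ) ≤ min ((rn : ℤ) - 1) ((sn : ℤ) - 1))
    (hk1 : min R S + max R S + 1 ≤ k) (hk2 : k ≤ p ^ n)
    (hl : l = t * p ^ n + k)
    (hl1 : max ((r : ℤ) + s - p ^ (n + 1)) 0 + 1 ≤ (l : ℤ)) (hl2 : l ≤ min r s)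
    (zl : Matrix (Fin r) (Fin s) F)
    (hzl : zl = (-1 : F) ^ (R + k - S - 1) •
      ∑ i ∈ Finset.range (t + 1), (-1 : F) ^ i •
        vv F r s (((i : ℤ) + 1) * p ^ n + R + S + 1 - k)
          (((t : ℤ) - i + 1) * p ^ n))
    (M5 : Matrix (Fin (t + 1)) (Fin (t + 1)) F)
    (hM5 : ∀ i j : Fin (t + 1), M5 i j =
      binF F ((rn : ℤ) + sn - 2 * t - 2) ((rn : ℤ) - t + (j : ℤ) - (i : ℤ) - 1))
    (X : Fin (t + 1) → F) (hX : ∀ i : Fin (t + 1), X i = (-1 : F) ^ (i : ℕ))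
    (zeta : Fin (t + 1) → F) (hzeta : zeta = M5⁻¹.mulVec X)
    (yl : Matrix (Fin r) (Fin s) F)
    (hyl : yl = (-1 : F) ^ (k + R - S - 1) •
      ∑ i : Fin (t + 1), zeta i •
        vv F r s (((rn : ℤ) - t + (i : ℤ)) * p ^ n + R + S + 1 - k)
          (((sn : ℤ) - (i : ℤ)) * p ^ n)) :
    ((TT F r s) ^ (p ^ n - 1)) zl
        = xx F r s (((t : ℤ) + 1) * p ^ n + R + S + 1 - k) ∧
      IsUnit M5 ∧
      ((TT F r s) ^ ((rn + sn - 2 * t - 2) * p ^ n)) yl = zl := by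
  have hq : 0 < p ^ n := Nat.pow_pos hp.pos
  have hRS : R + S + 1 ≤ k := by omega
  have hcast : ((p ^ n : ℕ) : ℤ) = (p : ℤ) ^ n := by push_cast; rfl
  have htr : t + 1 ≤ rn := by omega
  have hts : t + 1 ≤ sn := by omega
  have hrq : (rn : ℤ) * (p ^ n : ℕ) ≤ r := by rw [hrd]; push_cast; omega
  have hsq : (sn : ℤ) * (p ^ n : ℕ) ≤ s := by rw [hsd]; push_cast; omega
  have hneg : (-1 : F) ^ p ^ n = -1 := by
    have := Fact.mk hp
    exact neg_one_pow_char_pow F p n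
  have hsum : rn + sn - t ≤ p := by
    have h1 : ((r : ℤ) + s - p ^ (n + 1)) + 1 ≤ l :=
      (Int.add_le_add_right (le_max_left _ _) 1).trans hl1
    rw [hrd, hsd, hl, pow_succ'] at h1
    push_cast at h1
    rw [← hcast] at h1
    have h2 : ((rn : ℤ) + sn - p) * (p ^ n : ℕ) < ((t : ℤ) + 1) * (p ^ n : ℕ) := by
      have : (k : ℤ) ≤ (p ^ n : ℕ) := by exact_mod_cast hk2
      linarith
    have := lt_of_mul_lt_mul_right h2 (by omega)
    omega
  obtain ⟨c, hc⟩ : ∃ c, k = R + S + 1 + c := ⟨k - (R + S + 1), by omega⟩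
  have hsign : (-1 : F) ^ (R + k - S - 1) = (-1) ^ c := by
    rw [show R + k - S - 1 = R + R + c by omega, pow_add, ← two_mul, pow_mul]; simp
  simp only [← hcast] at hzl hyl ⊢
  set q := p ^ n with hqdef
  have hck : ((R : ℤ) + S + 1 - k) = -c := by omega
  have hshift : ∀ z : ℤ, z * q + R + S + 1 - k = z * q - c := fun z => by omega
  simp only [hshift] at hzl hyl ⊢
  have hunit : IsUnit M5 := by
    refine isUnit_of_binF_toeplitz F (p := p) (rn + sn - 2 * t - 2) (rn - t - 1) t
      (by omega) (by omega) M5 fun i j => ?_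
    rw [hM5]
    congr 1 <;> omega
  refine ⟨?_, hunit, ?_⟩
  · rw [hzl, hsign]
    have hm : (((t : ℤ) + 1) * q - c).toNat + c = (t + 1) * q := by
      have : (q : ℤ) ≤ (t + 1) * q := by nlinarith
      zify
      rw [Int.toNat_of_nonneg (by omega)]
      ring
    set g : ℕ → Matrix (Fin r) (Fin s) F := fun J =>
      (-1 : F) ^ J • vv F r s ((J : ℤ) + 1 - c) (((t : ℤ) + 1) * q - J) with hg
    have key : ∑ J ∈ Finset.range ((t + 1) * q), g J =
        (-1 : F) ^ c • xx F r s (((t : ℤ) + 1) * q - c) := by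
      rw [← hm, add_comm, Finset.sum_range_add, Finset.sum_eq_zero, zero_add, xx,
        Finset.smul_sum]
      · refine Finset.sum_congr rfl fun j _ => ?_
        rw [smul_smul, ← pow_add, hg]
        simp only
        congr 2 <;> push_cast <;> ring
      · intro J hJ
        rw [Finset.mem_range] at hJ
        rw [hg]
        simp only
        rw [vv_of_fst_nonpos F r s _ (by omega), smul_zero]
    have hz : (TT F r s ^ (q - 1)) (∑ i ∈ Finset.range (t + 1), (-1 : F) ^ i •
        vv F r s (((i : ℤ) + 1) * q - c) (((t : ℤ) - i + 1) * q)) =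
        ∑ J ∈ Finset.range ((t + 1) * q), g J := by
      rw [sum_range_mul_eq_sum_sum, map_sum]
      refine Finset.sum_congr rfl fun i hi => ?_
      rw [Finset.mem_range] at hi
      rw [map_smul, hqdef, TT_pow_prime_pow_sub_one_vv F hp, ← hqdef, Finset.smul_sum]
      · refine Finset.sum_congr rfl fun y _ => ?_
        rw [smul_smul, hg]
        simp only
        rw [pow_add, mul_comm i q, pow_mul, hneg]
        congr 2 <;> push_cast <;> ring
      · have : ((i : ℤ) + 1) * q ≤ rn * q := mul_le_mul_of_nonneg_right (by omega) (by omega)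
        rw [← hqdef]; omega
      · have : ((t : ℤ) - i + 1) * q ≤ sn * q := mul_le_mul_of_nonneg_right (by omega) (by omega)
        rw [← hqdef]; omega
    rw [map_smul, hz, key, smul_smul, ← pow_add, ← two_mul, pow_mul]
    simp
  · rw [hyl, hzl, show k + R - S - 1 = R + k - S - 1 by omega, map_smul, map_sum]
    congr 1
    set w : Fin (t + 1) → Matrix (Fin r) (Fin s) F := fun i =>
      vv F r s (((i : ℤ) + 1) * q - c) (((t : ℤ) - i + 1) * q) with hw
    have hterm : ∀ i : Fin (t + 1), (TT F r s ^ ((rn + sn - 2 * t - 2) * q))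
        (vv F r s (((rn : ℤ) - t + i) * q - c) (((sn : ℤ) - i) * q)) =
        ∑ i' : Fin (t + 1), M5 i' i • w i' := by
      intro i
      have hi := i.isLt
      rw [hqdef, TT_pow_mul_prime_pow_vv F hp, ← hqdef]
      · symm
        rw [Finset.Nat.sum_antidiagonal_eq_sum_range_succ_mk]
        refine Finset.sum_bij_ne_zero
          (fun i' _ _ => ((rn : ℤ) - t + (i : ℤ) - (i' : ℤ) - 1).toNat) ?_ ?_ ?_ ?_
        · intro i' _ h
          have hb := left_ne_zero_of_smul h
          rw [hM5, binF] at hb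
          have hb := (ite_ne_right_iff.mp hb).1
          rw [Finset.mem_range]
          omega
        · intro a _ ha b _ hb hab
          have ha := left_ne_zero_of_smul ha
          have hb := left_ne_zero_of_smul hb
          rw [hM5, binF] at ha hb
          have ha := (ite_ne_right_iff.mp ha).1
          have hb := (ite_ne_right_iff.mp hb).1
          ext
          omega
        · intro x hx h
          rw [Finset.mem_range] at hx
          have hv := right_ne_zero_of_smul h
          have h1 : 0 < ((rn : ℤ) - t + i - x) * q := by
            by_contra h1
            refine hv (vv_of_fst_nonpos F r s _ ?_)
            linarith
          have h2 : 0 < ((sn : ℤ) - i - ((rn + sn - 2 * t - 2 - x : ℕ) : ℤ)) * q := by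
            by_contra h2
            refine hv (vv_of_snd_nonpos F r s _ ?_)
            linarith
          have h1 := pos_of_mul_pos_left h1 (by omega)
          have h2 := pos_of_mul_pos_left h2 (by omega)
          have hlt : ((rn : ℤ) - t + i - x - 1).toNat < t + 1 := by omega
          have hbin : M5 ⟨_, hlt⟩ i = ((rn + sn - 2 * t - 2).choose x : F) := by
            rw [hM5, binF, if_pos (by simp only; omega)]
            congr 2
            · omega
            · dsimp only
              omega
          have hwx : w ⟨_, hlt⟩ = vv F r s (((rn : ℤ) - t + i) * q - c - (x : ℤ) * q)
              (((sn : ℤ) - i) * q - ((rn + sn - 2 * t - 2 - x : ℕ) : ℤ) * q) := by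
            have e1 : ((((rn : ℤ) - t + i - x - 1).toNat : ℕ) : ℤ) = (rn : ℤ) - t + i - x - 1 := by
              omega
            have e2 : ((rn + sn - 2 * t - 2 - x : ℕ) : ℤ) = (rn : ℤ) + sn - 2 * t - 2 - x := by
              omega
            simp only [hw, e1, e2]
            congr 1 <;> ring
          refine ⟨⟨_, hlt⟩, Finset.mem_univ _, ?_, by simp only; omega⟩
          rw [hbin, hwx, Nat.cast_smul_eq_nsmul F]
          exact h
        · intro i' _ h
          have hb := left_ne_zero_of_smul h
          rw [hM5, binF] at hb
          have hb := (ite_ne_right_iff.mp hb).1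
          have e1 : ((((rn : ℤ) - t + i - i' - 1).toNat : ℕ) : ℤ) = (rn : ℤ) - t + i - i' - 1 := by
            omega
          have e2 : ((rn + sn - 2 * t - 2 - ((rn : ℤ) - t + i - i' - 1).toNat : ℕ) : ℤ) =
              (sn : ℤ) - t - 1 - i + i' := by
            omega
          simp only [hM5, binF, hw, e1, e2]
          rw [if_pos hb, ← Nat.cast_smul_eq_nsmul F]
          congr 1
          · congr 2
            omega
          · congr 1 <;> ring
      · have : ((rn : ℤ) - t + i) * q ≤ rn * q := mul_le_mul_of_nonneg_right (by omega) (by omega)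
        rw [← hqdef]; omega
      · have : ((sn : ℤ) - i) * q ≤ sn * q := mul_le_mul_of_nonneg_right (by omega) (by omega)
        rw [← hqdef]; omega
    simp only [map_smul, hterm, Finset.smul_sum, smul_smul]
    rw [Finset.sum_comm, ← Fin.sum_univ_eq_sum_range (fun i => (-1 : F) ^ i •
      vv F r s (((i : ℤ) + 1) * q - c) (((t : ℤ) - i + 1) * q))]
    refine Finset.sum_congr rfl fun i' _ => ?_
    rw [← Finset.sum_smul, ← hX]
    congr 1
    have hXz : M5.mulVec zeta = X := by
      rw [hzeta, Matrix.mulVec_mulVec, Matrix.mul_nonsing_inv _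
        ((Matrix.isUnit_iff_isUnit_det _).mp hunit), Matrix.one_mulVec]
    rw [← hXz, Matrix.mulVec, dotProduct]
    exact Finset.sum_congr rfl fun _ _ => mul_comm _ _
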